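/- There exists a subshift X over a three-letter alphabet such that for every n ∈ ℕ with n ≥ 1, |F_X(n)| = 2n + 1, while for every n > 6, |E_X(n)| ≥ 2^{⌊n/4⌋}; that is, the number of follower sets of words of length n grows linearly while the number of extender sets of words of length n grows at least exponentially. -/

import Mathlib

/-- The finite word `w` occurs in the biinfinite sequence `x` starting at position `i`. -/
def WordAt {A : Type*} (x : ℤ → A) (i : ℤ) (w : List A) : Prop :=
  ∀ k : ℕ, (hk : k < w.length) → x (i + k) = w.get ⟨k, hk⟩

/-- A subshift: a closed, shift-invariant subset of `A^ℤ` (with the product topology,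
`A` carrying the discrete topology). -/
def IsSubshift {A : Type*} [TopologicalSpace A] (X : Set (ℤ → A)) : Prop :=
  IsClosed X ∧ (fun x : ℤ → A => fun i => x (i + 1)) '' X = X

/-- `w` belongs to the language of `X`: `w` occurs in some point of `X`. -/
def InLang {A : Type*} (X : Set (ℤ → A)) (w : List A) : Prop :=
  ∃ x ∈ X, ∃ i : ℤ, WordAt x i w

/-- The follower set of the word `w` in `X`: all right-infinite sequences `s`
such that `ws` occurs in some point of `X`. -/
def Follower {A : Type*} (X : Set (ℤ → A)) (w : List A) : Set (ℕ → A) :=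
  {s | ∃ x ∈ X, ∃ i : ℤ, WordAt x i w ∧ ∀ k : ℕ, x (i + w.length + k) = s k}

/-- `F_X(n)`: the collection of follower sets of words of length `n` in `X`. -/
def FollowerSets {A : Type*} (X : Set (ℤ → A)) (n : ℕ) : Set (Set (ℕ → A)) :=
  {F | ∃ w : List A, w.length = n ∧ InLang X w ∧ Follower X w = F}

/-- A subshift is sofic iff it has only finitely many follower sets. -/
def Sofic {A : Type*} (X : Set (ℤ → A)) : Prop :=
  {F | ∃ w : List A, InLang X w ∧ Follower X w = F}.Finite

/-- The extender set of the word `w` in `X`: all pairs `(p, s)` of a left-infinite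
sequence `p` (indexed so that `p k` is the symbol at distance `k+1` to the left of `w`)
and a right-infinite sequence `s` such that `pws` is a point of `X`. -/
def Extender {A : Type*} (X : Set (ℤ → A)) (w : List A) : Set ((ℕ → A) × (ℕ → A)) :=
  {ps | ∃ x ∈ X, ∃ i : ℤ, WordAt x i w ∧ (∀ k : ℕ, x (i - 1 - k) = ps.1 k) ∧
    (∀ k : ℕ, x (i + w.length + k) = ps.2 k)}

/-- `E_X(n)`: the collection of extender sets of words of length `n` in `X`. -/
def ExtenderSets {A : Type*} (X : Set (ℤ → A)) (n : ℕ) : Set (Set ((ℕ → A) × (ℕ → A))) :=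
  {E | ∃ w : List A, w.length = n ∧ InLang X w ∧ Extender X w = E}

/-- States of the (infinite) deterministic automaton recognising the subshift. -/
inductive Q : Type
  | zero | B (j : ℕ) | free | C (m : ℕ) | bin | dead

namespace Q

/-- Transition function. -/
def step : Q → Fin 3 → Q
  | zero, 0 => zero
  | zero, 1 => B 0
  | zero, 2 => free
  | B j, 0 => B (j + 1)
  | B _, 1 => B 0
  | B 0, 2 => free
  | B (j + 1), 2 => C j
  | free, 0 => free
  | free, 1 => free
  | free, 2 => bin
  | C 0, 0 => free
  | C 0, 1 => bin
  | C (m + 1), 0 => C m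
  | C (m + 1), 1 => C m
  | C _, 2 => bin
  | bin, 0 => bin
  | bin, 1 => bin
  | bin, 2 => dead
  | dead, _ => dead

def rank : Q → ℕ
  | zero => 5
  | B _ => 4
  | free => 3
  | C _ => 2
  | bin => 1
  | dead => 0

def le (q r : Q) : Prop := q = r ∨ rank q < rank r

theorem le_step {q r : Q} (h : le q r) (a : Fin 3) : le (step q a) (step r a) := by
  rcases h with rfl | h
  · left; rfl
  · fin_cases a <;> rcases q with _ | ⟨_ | j⟩ | _ | ⟨_ | m⟩ | _ | _ <;>
      rcases r with _ | ⟨_ | j'⟩ | _ | ⟨_ | m'⟩ | _ | _ <;>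
      simp_all [rank, le, step]

theorem le_zero (q : Q) : le q zero := by
  cases q <;> simp [le, rank]

theorem alive_of_le {q r : Q} (h : le q r) (hq : q ≠ dead) : r ≠ dead := by
  rcases h with rfl | h
  · exact hq
  · rintro rfl
    simp [rank] at h

theorem step_binary {q : Q} (hq : q ≠ dead) {a : Fin 3} (ha : a ≠ 2) : step q a ≠ dead := by
  fin_cases a <;> rcases q with _ | ⟨_ | j⟩ | _ | ⟨_ | m⟩ | _ | _ <;> simp_all [step]

/-- Run of the automaton on a right-infinite sequence. -/
def rn (q : Q) (t : ℕ → Fin 3) : ℕ → Q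
  | 0 => q
  | n + 1 => step (rn q t n) (t n)

theorem rn_mono {q r : Q} (h : le q r) (t : ℕ → Fin 3) (n : ℕ) : le (rn q t n) (rn r t n) := by
  induction n with
  | zero => exact h
  | succ n ih => exact le_step ih _

theorem rn_add (q : Q) (t : ℕ → Fin 3) (m n : ℕ) :
    rn q t (m + n) = rn (rn q t m) (fun k => t (m + k)) n := by
  induction n with
  | zero => rfl
  | succ n ih => rw [← add_assoc]; simp only [rn, ih]

theorem rn_dead (t : ℕ → Fin 3) (n : ℕ) : rn dead t n = dead := by
  induction n with
  | zero => rfl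
  | succ n ih => simp [rn, ih, step]

theorem rn_binary {q : Q} (hq : q ≠ dead) (t : ℕ → Fin 3) (n : ℕ) (ht : ∀ k < n, t k ≠ 2) :
    rn q t n ≠ dead := by
  induction n with
  | zero => exact hq
  | succ n ih => exact step_binary (ih fun k hk => ht k (by omega)) (ht n (by omega))

theorem rn_zero (t : ℕ → Fin 3) (n : ℕ) (ht : ∀ k < n, t k = 0) : rn zero t n = zero := by
  induction n with
  | zero => rfl
  | succ n ih => simp [rn, ih fun k hk => ht k (by omega), ht n (by omega), step]

theorem rn_alive_of_add {q : Q} {t : ℕ → Fin 3} {m n : ℕ} (h : rn q t (m + n) ≠ dead) :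
    rn q t m ≠ dead := by
  intro h'
  rw [rn_add, h', rn_dead] at h
  exact h rfl

/-- Run on a finite word. -/
def run (q : Q) (w : List (Fin 3)) : Q := w.foldl step q

theorem rn_list (q : Q) (t : ℕ → Fin 3) (w : List (Fin 3))
    (h : ∀ k : ℕ, (hk : k < w.length) → t k = w.get ⟨k, hk⟩) : rn q t w.length = run q w := by
  induction w generalizing q t with
  | nil => rfl
  | cons a w ih =>
    rw [List.length_cons, add_comm, rn_add, ih]
    · have := h 0 (by simp)
      simp only [rn, run, List.foldl_cons]
      rw [this]; rfl
    · intro k hk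
      have := h (1 + k) (by simp; omega)
      rw [this]
      simp [add_comm 1 k]

/-- Right-infinite sequences along which the automaton survives from state `q`. -/
def L (q : Q) : Set (ℕ → Fin 3) := {s | ∀ n, rn q s n ≠ dead}

/-- Prepend a word to a sequence. -/
def pre (w : List (Fin 3)) (s : ℕ → Fin 3) (k : ℕ) : Fin 3 :=
  if h : k < w.length then w.get ⟨k, h⟩ else s (k - w.length)

theorem rn_pre (q : Q) (w : List (Fin 3)) (s : ℕ → Fin 3) (n : ℕ) :
    rn q (pre w s) (w.length + n) = rn (run q w) s n := by
  rw [rn_add, rn_list q (pre w s) w (fun k hk => by simp [pre, hk])]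
  congr 1
  funext k
  simp [pre]

theorem pre_mem_L (q : Q) (w : List (Fin 3)) (s : ℕ → Fin 3) :
    pre w s ∈ L q ↔ s ∈ L (run q w) := by
  constructor
  · intro h n
    rw [← rn_pre]; exact h _
  · intro h n
    have := h n
    rw [← rn_pre, add_comm] at this
    exact rn_alive_of_add this

theorem zeros_mem_L (q : Q) : (fun _ => 0) ∈ L q ↔ q ≠ dead := by
  constructor
  · intro h; exact h 0
  · intro h n; exact rn_binary h _ _ (by simp)

theorem L_run {q r : Q} (h : L q = L r) (w : List (Fin 3)) :
    run q w = dead ↔ run r w = dead := by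
  have := pre_mem_L q w (fun _ => 0)
  rw [h, pre_mem_L, zeros_mem_L, zeros_mem_L] at this
  tauto

theorem run_append (q : Q) (u v : List (Fin 3)) : run q (u ++ v) = run (run q u) v := by
  simp [run]

theorem run_free0 (n : ℕ) : run free (List.replicate n 0) = free := by
  induction n with
  | zero => rfl
  | succ n ih => simpa [run, List.replicate_succ, step] using ih

theorem run_C0 (d n : ℕ) : run (C (n + d)) (List.replicate n 0) = C d := by
  induction n with
  | zero => simp [run]
  | succ n ih =>
    have : n + 1 + d = (n + d) + 1 := by omega
    rw [this]
    simpa [run, List.replicate_succ, step] using ih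

theorem test_C (m m' : ℕ) (h : m ≤ m') :
    run (C m') (List.replicate m 0 ++ [1, 2]) = dead ↔ m' = m := by
  obtain ⟨d, rfl⟩ := Nat.exists_eq_add_of_le h
  rw [run_append, run_C0]
  cases d <;> simp [run, step]

theorem test_free (m : ℕ) : run free (List.replicate m 0 ++ [1, 2]) ≠ dead := by
  rw [run_append, run_free0]; simp [run, step]

theorem C_inj {m m' : ℕ} (h : L (C m) = L (C m')) : m = m' := by
  rcases le_total m m' with h1 | h1
  · have := L_run h (List.replicate m 0 ++ [1, 2])
    rw [test_C _ _ h1, test_C _ _ le_rfl] at this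
    exact (this.1 rfl).symm
  · have := L_run h (List.replicate m' 0 ++ [1, 2])
    rw [test_C _ _ h1, test_C _ _ le_rfl] at this
    exact this.2 rfl

theorem L_step {q r : Q} (h : L q = L r) (w : List (Fin 3)) : L (run q w) = L (run r w) := by
  ext s
  rw [← pre_mem_L, ← pre_mem_L, h]

theorem free_ne_C {m : ℕ} (h : L free = L (C m)) : False :=
  test_free m ((L_run h _).2 ((test_C _ _ le_rfl).2 rfl))

theorem L_inj {q r : Q} (h : L q = L r) : q = r := by
  have h0 := L_run h []
  have h2 := L_run h [2]
  have h22 := L_run h [2, 2]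
  have h02 := L_step h [0, 2]
  rcases q with _ | j | _ | m | _ | _ <;> rcases r with _ | j' | _ | m' | _ | _
  all_goals first
    | rfl
    | (exfalso; simp [run, step] at h0 h2; done)
    | (exfalso; revert h22; rcases j with _ | j <;> simp [run, step]; done)
    | (exfalso; revert h22; rcases j' with _ | j' <;> simp [run, step]; done)
    | (exfalso; revert h22; simp [run, step]; done)
    | (exact absurd h02 (fun h => free_ne_C h))
    | (exact absurd h02.symm (fun h => free_ne_C h))
    | (exact absurd h (fun h => free_ne_C h))
    | (exact absurd h.symm (fun h => free_ne_C h))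
    | (rw [C_inj h]; done)
    | (rw [C_inj (m := j) (m' := j') h02])

/-- States reachable in exactly `n` steps (other than `dead`). -/
def T (n : ℕ) : Q → Prop
  | zero => True
  | B j => j < n
  | free => 1 ≤ n
  | C m => m + 3 ≤ n
  | bin => 2 ≤ n
  | dead => False

theorem T_step {n : ℕ} {q : Q} (h : T n q) (a : Fin 3) (ha : step q a ≠ dead) :
    T (n + 1) (step q a) := by
  fin_cases a <;> rcases q with _ | ⟨_ | j⟩ | _ | ⟨_ | m⟩ | _ | _ <;>
    simp_all [step, T] <;> omega

theorem T_pred {n : ℕ} {q : Q} (h : T (n + 1) q) : ∃ r a, T n r ∧ step r a = q := by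
  rcases q with _ | ⟨_ | j⟩ | _ | m | _ | _
  · exact ⟨zero, 0, trivial, rfl⟩
  · exact ⟨zero, 1, trivial, rfl⟩
  · exact ⟨B j, 0, by simp only [T] at *; omega, rfl⟩
  · exact ⟨zero, 2, trivial, rfl⟩
  · exact ⟨B (m + 1), 2, by simp only [T] at *; omega, rfl⟩
  · exact ⟨free, 2, by simp only [T] at *; omega, rfl⟩
  · exact h.elim

theorem T_of_run (w : List (Fin 3)) : run zero w ≠ dead → T w.length (run zero w) := by
  induction w using List.reverseRecOn with
  | nil => intro; trivial
  | append_singleton w a ih =>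
    intro h
    rw [run_append] at h ⊢
    rw [List.length_append]
    refine T_step (ih ?_) a h
    intro h'
    rw [h'] at h
    exact h rfl

theorem run_of_T (n : ℕ) (q : Q) (h : T n q) : ∃ w : List (Fin 3), w.length = n ∧ run zero w = q := by
  induction n generalizing q with
  | zero =>
    cases q <;> simp [T] at h
    exact ⟨[], rfl, rfl⟩
  | succ n ih =>
    obtain ⟨r, a, hr, rfl⟩ := T_pred h
    obtain ⟨w, hw, rfl⟩ := ih r hr
    exact ⟨w ++ [a], by simp [hw], by rw [run_append]; rfl⟩

theorem T_ne_dead {n : ℕ} {q : Q} (h : T n q) : q ≠ dead := by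
  rintro rfl; exact h

theorem T_card (n : ℕ) (hn : 1 ≤ n) : {q | T n q}.ncard = 2 * n + 1 := by
  classical
  obtain rfl | h2 : n = 1 ∨ 2 ≤ n := by omega
  · have : {q | T 1 q} = (({zero, B 0, free} : Finset Q) : Set Q) := by
      ext q
      cases q <;> simp [T]
    rw [this, Set.ncard_coe_finset]; simp
  · have : {q | T n q} = ((({zero, free, bin} : Finset Q) ∪
        ((Finset.range n).image B ∪ (Finset.range (n - 2)).image C) : Finset Q) : Set Q) := by
      ext q
      cases q <;> simp [T] <;> omega
    rw [this, Set.ncard_coe_finset, Finset.card_union_of_disjoint, Finset.card_union_of_disjoint,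
      Finset.card_image_of_injective _ (fun a b h => by injection h),
      Finset.card_image_of_injective _ (fun a b h => by injection h)]
    · have : ({zero, free, bin} : Finset Q).card = 3 := by simp
      rw [this, Finset.card_range, Finset.card_range]; omega
    · rw [Finset.disjoint_left]; intro q; simp only [Finset.mem_image]
      rintro ⟨a, _, rfl⟩ ⟨b, _, h⟩; cases h
    · rw [Finset.disjoint_left]; intro q; cases q <;> simp

/-- The subshift. -/
def X : Set (ℤ → Fin 3) := {x | ∀ (i : ℤ) (n : ℕ), rn zero (fun k => x (i + k)) n ≠ dead}

theorem isClosed_X : IsClosed X := by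
  have : X = ⋂ (i : ℤ) (n : ℕ), {x | rn zero (fun k => x (i + k)) n ≠ dead} := by
    ext x; simp [X]
  rw [this]
  refine isClosed_iInter fun i => isClosed_iInter fun n => ?_
  letI : TopologicalSpace Q := ⊥
  haveI : DiscreteTopology Q := ⟨rfl⟩
  have hc : Continuous (fun x : ℤ → Fin 3 => rn zero (fun k => x (i + k)) n) := by
    induction n with
    | zero => exact continuous_const
    | succ n ih =>
      have h2 : Continuous (fun p : Q × Fin 3 => step p.1 p.2) := continuous_of_discreteTopology
      exact h2.comp (ih.prodMk (continuous_apply _))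
  exact (isClosed_discrete {q : Q | q ≠ dead}).preimage hc

theorem isSubshift_X : IsSubshift X := by
  refine ⟨isClosed_X, ?_⟩
  ext x
  constructor
  · rintro ⟨y, hy, rfl⟩ i n
    have := hy (i + 1) n
    convert this using 4
    ring
  · intro hx
    refine ⟨fun i => x (i - 1), ?_, ?_⟩
    · intro i n
      have := hx (i - 1) n
      convert this using 4
      ring
    · funext i; simp

theorem mem_X_of_left_zero {x : ℤ → Fin 3} (a : ℤ) (h0 : ∀ i < a, x i = 0)
    (h : ∀ n, rn zero (fun k => x (a + k)) n ≠ dead) : x ∈ X := by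
  intro i n
  rcases le_total a i with hi | hi
  · obtain ⟨m, rfl⟩ := Int.le.dest hi
    have h1 := h (m + n)
    rw [rn_add] at h1
    have := alive_of_le (rn_mono (le_zero _) _ _) h1
    convert this using 4
    push_cast; ring
  · obtain ⟨m, rfl⟩ := Int.le.dest hi
    have h1 := h n
    have h2 : rn zero (fun k => x (i + k)) (m + n) ≠ dead := by
      rw [rn_add, rn_zero]
      · convert h1 using 4
        push_cast; ring
      · intro k hk
        exact h0 _ (by omega)
    rw [add_comm] at h2
    exact rn_alive_of_add h2

theorem alive_of_wordAt {x : ℤ → Fin 3} (hx : x ∈ X) {i : ℤ} {w : List (Fin 3)}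
    (h : WordAt x i w) : (fun k : ℕ => x (i + w.length + k)) ∈ L (run zero w) := by
  intro n
  have := hx i (w.length + n)
  rw [rn_add, rn_list _ _ w h] at this
  convert this using 4
  push_cast; ring

/-- Extend a one-sided sequence by zeros to the left. -/
def ext0 (t : ℕ → Fin 3) (i : ℤ) : Fin 3 := if i < 0 then 0 else t i.toNat

theorem follower_X (w : List (Fin 3)) : Follower X w = L (run zero w) := by
  ext s
  constructor
  · rintro ⟨x, hx, i, hw, hs⟩
    have := alive_of_wordAt hx hw
    rwa [funext hs] at this
  · intro hs
    have hs' := (pre_mem_L zero w s).2 hs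
    refine ⟨ext0 (pre w s), mem_X_of_left_zero 0 ?_ ?_, 0, ?_, ?_⟩
    · intro i hi; simp [ext0, hi]
    · intro n
      have := hs' n
      convert this using 2
      funext k
      simp [ext0]
    · intro k hk
      have : ¬ ((k : ℤ) < 0) := by omega
      simp [ext0, pre, hk, this]
    · intro k
      have h1 : ¬ ((w.length : ℤ) + k < 0) := by omega
      have h2 : ((w.length : ℤ) + k).toNat = w.length + k := by omega
      simp [ext0, pre, h1, h2]

theorem inLang_X (w : List (Fin 3)) : InLang X w ↔ run zero w ≠ dead := by
  constructor
  · rintro ⟨x, hx, i, hw⟩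
    exact alive_of_wordAt hx hw 0
  · intro h
    have := (zeros_mem_L _).2 h
    rw [← follower_X] at this
    obtain ⟨x, hx, i, hw, -⟩ := this
    exact ⟨x, hx, i, hw⟩

theorem followerSets_X (n : ℕ) : FollowerSets X n = L '' {q | T n q} := by
  ext F
  constructor
  · rintro ⟨w, rfl, hw, rfl⟩
    exact ⟨run zero w, T_of_run w ((inLang_X w).1 hw), (follower_X w).symm⟩
  · rintro ⟨q, hq, rfl⟩
    obtain ⟨w, hw, rfl⟩ := run_of_T n q hq
    exact ⟨w, hw, (inLang_X w).2 (T_ne_dead hq), follower_X w⟩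

theorem followers_card (n : ℕ) (hn : 1 ≤ n) : (FollowerSets X n).ncard = 2 * n + 1 := by
  rw [followerSets_X, Set.ncard_image_of_injective _ (fun _ _ h => L_inj h), T_card n hn]

theorem run_free (w : List (Fin 3)) (hw : ∀ a ∈ w, a ≠ 2) : run free w = free := by
  induction w with
  | nil => rfl
  | cons a w ih =>
    have h1 := ih fun b hb => hw b (by simp [hb])
    have h2 := hw a (by simp)
    fin_cases a <;> simp_all [run, step]

theorem run_bin (w : List (Fin 3)) (hw : ∀ a ∈ w, a ≠ 2) : run bin w = bin := by
  induction w with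
  | nil => rfl
  | cons a w ih =>
    have h1 := ih fun b hb => hw b (by simp [hb])
    have h2 := hw a (by simp)
    fin_cases a <;> simp_all [run, step]

theorem run_C (w : List (Fin 3)) (hw : ∀ a ∈ w, a ≠ 2) (k : ℕ) (hk : k < w.length) :
    run (C k) w = if w[k] = 0 then free else bin := by
  induction w generalizing k with
  | nil => simp at hk
  | cons a w ih =>
    have hw' : ∀ b ∈ w, b ≠ 2 := fun b hb => hw b (by simp [hb])
    have h2 := hw a (by simp)
    have hf := run_free w hw'
    have hb := run_bin w hw'
    rcases k with _ | k
    · fin_cases a <;> simp_all [run, step]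
    · have := ih hw' k (by simpa using hk)
      fin_cases a <;> simp_all [run, step]

theorem run_binary {q : Q} (hq : q ≠ dead) (w : List (Fin 3)) (hw : ∀ a ∈ w, a ≠ 2) :
    run q w ≠ dead := by
  induction w generalizing q with
  | nil => exact hq
  | cons a w ih =>
    exact ih (q := step q a) (step_binary hq (hw a (by simp))) fun b hb => hw b (by simp [hb])

theorem rn_key (t : ℕ → Fin 3) (k : ℕ) (w : List (Fin 3)) (h1 : t 0 = 1)
    (h0 : ∀ j, 1 ≤ j → j ≤ k + 1 → t j = 0) (h2 : t (k + 2) = 2)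
    (hw : ∀ j : ℕ, (hj : j < w.length) → t (k + 3 + j) = w.get ⟨j, hj⟩)
    (h3 : t (k + 3 + w.length) = 2) :
    rn zero t (k + 3 + w.length + 1) = step (run (C k) w) 2 := by
  have hB : ∀ j ≤ k + 1, rn zero t (j + 1) = B j := by
    intro j hj
    induction j with
    | zero => simp [rn, h1, step]
    | succ j ih =>
      rw [rn, ih (by omega), h0 _ (by omega) hj]; rfl
  have hC : rn zero t (k + 3) = C k := by
    rw [rn, hB (k + 1) le_rfl, h2]; rfl
  rw [rn, h3, rn_add, hC, rn_list _ _ w hw]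

/-- The left part of the test context. -/
def pk (k j : ℕ) : Fin 3 := if j = 0 then 2 else if j = k + 2 then 1 else 0

/-- The right part of the test context. -/
def sk (j : ℕ) : Fin 3 := if j = 0 then 2 else 0

theorem mem_extender (w : List (Fin 3)) (hw : ∀ a ∈ w, a ≠ 2) (k : ℕ) (hk : k < w.length) :
    (pk k, sk) ∈ Extender X w ↔ w[k] = 0 := by
  have key : ∀ (x : ℤ → Fin 3) (i : ℤ), WordAt x i w → (∀ j : ℕ, x (i - 1 - j) = pk k j) →
      (∀ j : ℕ, x (i + w.length + j) = sk j) →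
      rn zero (fun j => x (i - (k + 3) + j)) (k + 3 + w.length + 1) =
        if w[k] = 0 then bin else dead := by
    intro x i h1 h2 h3
    rw [rn_key _ k w, run_C w hw k hk]
    · split_ifs <;> rfl
    · have := h2 (k + 2)
      convert this using 2
      · push_cast; ring
      · simp [pk]
    · intro j hj1 hj2
      have := h2 (k + 2 - j)
      convert this using 2
      · omega
      · rw [pk, if_neg (by omega), if_neg (by omega)]
    · have := h2 0
      convert this using 2
      · push_cast; ring
      · simp [pk, sk]
    · intro j hj
      rw [← h1 j hj]
      congr 1
      push_cast; ring
    · have := h3 0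
      convert this using 2
      · push_cast; ring
      · simp [pk, sk]
  constructor
  · rintro ⟨x, hx, i, h1, h2, h3⟩
    by_contra hne
    have := key x i h1 h2 h3
    rw [if_neg hne] at this
    exact hx _ _ this
  · intro h
    let x : ℤ → Fin 3 := fun i => if i < 0 then pk k (-1 - i).toNat else pre w sk i.toNat
    have h1 : WordAt x 0 w := by
      intro j hj
      have : ¬ ((j : ℤ) < 0) := by omega
      simp [x, pre, hj, this]
    have h2 : ∀ j : ℕ, x (0 - 1 - j) = pk k j := by
      intro j
      have e1 : (0 - 1 - (j : ℤ)) < 0 := by omega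
      have e2 : (-1 - (0 - 1 - (j : ℤ))).toNat = j := by omega
      simp only [x, if_pos e1, e2]
    have h3 : ∀ j : ℕ, x (0 + w.length + j) = sk j := by
      intro j
      have e1 : ¬ ((0 + (w.length : ℤ) + j) < 0) := by omega
      have e2 : (0 + (w.length : ℤ) + j).toNat = w.length + j := by omega
      simp only [x, if_neg e1, e2]
      simp [pre]
    refine ⟨x, mem_X_of_left_zero (0 - (k + 3)) ?_ ?_, 0, h1, h2, h3⟩
    · intro i hi
      have := h2 (-1 - i).toNat
      have e : (0 - 1 - ((-1 - i).toNat : ℤ)) = i := by omega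
      rw [e] at this
      rw [this, pk, if_neg (by omega), if_neg (by omega)]
    · intro n
      have e := key x 0 h1 h2 h3
      rw [if_pos h] at e
      have : rn zero (fun j : ℕ => x (0 - (k + 3) + j)) (k + 3 + w.length + 1 + n) ≠ dead := by
        rw [rn_add, e]
        apply rn_binary (by simp)
        intro j _
        have := h3 (j + 1)
        have e : (0 - ((k : ℤ) + 3) + ((k + 3 + w.length + 1 + j : ℕ) : ℤ)) =
            0 + w.length + ((j + 1 : ℕ) : ℤ) := by push_cast; ring
        rw [e, this]
        simp [sk]
      rw [add_comm _ n] at this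
      exact rn_alive_of_add this

/-- Binary words. -/
def bw {n : ℕ} (f : Fin n → Bool) : List (Fin 3) := List.ofFn fun i => if f i then 1 else 0

theorem bw_binary {n : ℕ} (f : Fin n → Bool) : ∀ a ∈ bw f, a ≠ 2 := by
  intro a ha
  simp only [bw, List.mem_ofFn] at ha
  obtain ⟨i, rfl⟩ := ha
  split_ifs <;> decide

theorem extenders_card (n : ℕ) : 2 ^ n ≤ (ExtenderSets X n).ncard := by
  have hfin : (ExtenderSets X n).Finite := by
    refine ((List.finite_length_eq (Fin 3) n).image (Extender X)).subset ?_
    rintro E ⟨w, hw, _, rfl⟩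
    exact ⟨w, hw, rfl⟩
  have hinj : Function.Injective (fun f : Fin n → Bool => Extender X (bw f)) := by
    intro f g h
    funext i
    have hf := mem_extender (bw f) (bw_binary f) i (by simp [bw])
    have hg := mem_extender (bw g) (bw_binary g) i (by simp [bw])
    have h : Extender X (bw f) = Extender X (bw g) := h
    rw [h, hg] at hf
    simp only [bw, List.getElem_ofFn] at hf
    cases hfi : f i <;> cases hgi : g i <;> simp_all
  have hsub : Set.range (fun f : Fin n → Bool => Extender X (bw f)) ⊆ ExtenderSets X n := by
    rintro E ⟨f, rfl⟩
    exact ⟨bw f, by simp [bw], (inLang_X _).2 (run_binary (by simp) _ (bw_binary f)), rfl⟩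
  have := Set.ncard_le_ncard hsub hfin
  rw [← Set.image_univ, Set.ncard_image_of_injective _ hinj, Set.ncard_univ] at this
  simpa using this

end Q

/-- There is a subshift over a three-letter alphabet with `|F_X(n)| = 2n + 1` for all
`n ≥ 1` (linear growth) while `|E_X(n)| ≥ 2^{⌊n/4⌋}` for all `n > 6`
(at least exponential growth). -/
theorem exists_subshift_linear_followers_exp_extenders :
    ∃ X : Set (ℤ → Fin 3), IsSubshift X ∧
      (∀ n : ℕ, 1 ≤ n → (FollowerSets X n).ncard = 2 * n + 1) ∧
      (∀ n : ℕ, 6 < n → 2 ^ (n / 4) ≤ (ExtenderSets X n).ncard) := by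
  exact ⟨Q.X, Q.isSubshift_X, Q.followers_card, fun n _ =>
    le_trans (Nat.pow_le_pow_right (by norm_num) (Nat.div_le_self n 4)) (Q.extenders_card n)⟩
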